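/- Define the linear map Ω : n_p → End(n_p) by Ω(ξᵢ) = −λHᵢ for i = 1, 2, 3 and Ω(τₗ) = 0 for l = 1, …, 4p. Then the curvature of the corresponding left-invariant connection equals λ²(H₁⊗H₁ + H₂⊗H₂ + H₃⊗H₃): for all X, Y ∈ n_p, [Ω(X), Ω(Y)] − Ω([X, Y]) = λ² Σ_{i=1}^{3} Hᵢ(X, Y)·Hᵢ as endomorphisms of n_p. -/

import Mathlib

/-! Common setup: the quaternionic Heisenberg Lie algebra `n_p` of dimension `4p+3`,
realised as `ℝ^{4p+3}` with orthonormal basis `ξ₁ ξ₂ ξ₃ τ₁ … τ_{4p}`. -/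

noncomputable section

open scoped BigOperators

/-- The underlying vector space of the quaternionic Heisenberg Lie algebra `n_p`. -/
abbrev NV (p : ℕ) : Type := Fin (4 * p + 3) → ℝ

/-- The inner product `g_λ` for which the standard basis is orthonormal. -/
def gIP {p : ℕ} (X Y : NV p) : ℝ := ∑ a, X a * Y a

/-- Index of the basis vector `ξ_{i+1}`, `i = 0, 1, 2`. -/
def zI (p : ℕ) (i : Fin 3) : Fin (4 * p + 3) := ⟨i.val, by have := i.isLt; omega⟩

/-- Index of the basis vector `τ_{ip + r + 1}`, `i = 0, 1, 2, 3`, `r = 0, …, p-1`. -/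
def tI (p : ℕ) (i : Fin 4) (r : Fin p) : Fin (4 * p + 3) :=
  ⟨3 + i.val * p + r.val, by
    have h1 := i.isLt; have h2 := r.isLt
    have h3 : i.val * p ≤ 3 * p := Nat.mul_le_mul_right p (by omega)
    omega⟩

/-- The basis vector `ξ_{i+1}`. -/
def xi (p : ℕ) (i : Fin 3) : NV p := Pi.single (zI p i) 1

/-- The basis vector `τ_{ip + r + 1}`. -/
def tau (p : ℕ) (i : Fin 4) (r : Fin p) : NV p := Pi.single (tI p i r) 1

/-- The Lie bracket of `n_p`: the bilinear extension of
`[τ_r, τ_{p+r}] = [τ_{2p+r}, τ_{3p+r}] = λ ξ₁`, `[τ_r, τ_{2p+r}] = [τ_{3p+r}, τ_{p+r}] = λ ξ₂`,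
`[τ_r, τ_{3p+r}] = [τ_{p+r}, τ_{2p+r}] = λ ξ₃`, all other brackets of basis vectors being zero. -/
def bracket (p : ℕ) (lam : ℝ) (X Y : NV p) : NV p :=
  (lam * ∑ r : Fin p,
      (X (tI p 0 r) * Y (tI p 1 r) - X (tI p 1 r) * Y (tI p 0 r)
        + X (tI p 2 r) * Y (tI p 3 r) - X (tI p 3 r) * Y (tI p 2 r))) • xi p 0
  + (lam * ∑ r : Fin p,
      (X (tI p 0 r) * Y (tI p 2 r) - X (tI p 2 r) * Y (tI p 0 r)
        + X (tI p 3 r) * Y (tI p 1 r) - X (tI p 1 r) * Y (tI p 3 r))) • xi p 1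
  + (lam * ∑ r : Fin p,
      (X (tI p 0 r) * Y (tI p 3 r) - X (tI p 3 r) * Y (tI p 0 r)
        + X (tI p 1 r) * Y (tI p 2 r) - X (tI p 2 r) * Y (tI p 1 r))) • xi p 2

/-- `dη_i(X, Y) := -η_i([X, Y])`. -/
def dEta (p : ℕ) (lam : ℝ) (i : Fin 3) (X Y : NV p) : ℝ := -(bracket p lam X Y (zI p i))

/-- The three almost contact endomorphisms `φ₁, φ₂, φ₃` of `n_p`. -/
def phi (p : ℕ) : Fin 3 → NV p → NV p :=
  ![fun X => X (zI p 1) • xi p 2 - X (zI p 2) • xi p 1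
      + ∑ r : Fin p, (X (tI p 0 r) • tau p 1 r - X (tI p 1 r) • tau p 0 r
          + X (tI p 2 r) • tau p 3 r - X (tI p 3 r) • tau p 2 r),
    fun X => X (zI p 2) • xi p 0 - X (zI p 0) • xi p 2
      + ∑ r : Fin p, (X (tI p 0 r) • tau p 2 r - X (tI p 2 r) • tau p 0 r
          + X (tI p 3 r) • tau p 1 r - X (tI p 1 r) • tau p 3 r),
    fun X => X (zI p 0) • xi p 1 - X (zI p 1) • xi p 0
      + ∑ r : Fin p, (X (tI p 0 r) • tau p 3 r - X (tI p 3 r) • tau p 0 r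
          + X (tI p 1 r) • tau p 2 r - X (tI p 2 r) • tau p 1 r)]

/-- `(η_i ∧ η_j)(X, Y)`. -/
def etaWedge (p : ℕ) (i j : Fin 3) (X Y : NV p) : ℝ :=
  X (zI p i) * Y (zI p j) - Y (zI p i) * X (zI p j)

/-- The 2-forms `H₁ = -(1/λ)dη₁ + 2 η₂∧η₃`, `H₂ = -(1/λ)dη₂ - 2 η₁∧η₃`,
`H₃ = -(1/λ)dη₃ + 2 η₁∧η₂`. -/
def Hform (p : ℕ) (lam : ℝ) : Fin 3 → NV p → NV p → ℝ :=
  ![fun X Y => -(1 / lam) * dEta p lam 0 X Y + 2 * etaWedge p 1 2 X Y,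
    fun X Y => -(1 / lam) * dEta p lam 1 X Y - 2 * etaWedge p 0 2 X Y,
    fun X Y => -(1 / lam) * dEta p lam 2 X Y + 2 * etaWedge p 0 1 X Y]

/-- The 2-form `H_i` regarded as an endomorphism of `n_p` via `g_λ(H_i X, Y) = H_i(X, Y)`. -/
def Hend (p : ℕ) (lam : ℝ) (i : Fin 3) (X : NV p) : NV p :=
  fun b => Hform p lam i X (Pi.single b 1)

/-- `(η₁ ∧ η₂ ∧ η₃)(X, Y, Z)`. -/
def det3 (p : ℕ) (X Y Z : NV p) : ℝ :=
  X (zI p 0) * (Y (zI p 1) * Z (zI p 2) - Y (zI p 2) * Z (zI p 1))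
  - Y (zI p 0) * (X (zI p 1) * Z (zI p 2) - X (zI p 2) * Z (zI p 1))
  + Z (zI p 0) * (X (zI p 1) * Y (zI p 2) - X (zI p 2) * Y (zI p 1))

/-- The torsion 3-form `T = η₁∧dη₁ + η₂∧dη₂ + η₃∧dη₃ - 4λ η₁∧η₂∧η₃`. -/
def Tform (p : ℕ) (lam : ℝ) (X Y Z : NV p) : ℝ :=
  (∑ i : Fin 3,
    (X (zI p i) * dEta p lam i Y Z - Y (zI p i) * dEta p lam i X Z
      + Z (zI p i) * dEta p lam i X Y)) - 4 * lam * det3 p X Y Z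

/-- The standard basis vector `e_a` of `n_p`. -/
def basisE (p : ℕ) (a : Fin (4 * p + 3)) : NV p := Pi.single a 1

end

section QuaternionicHeisenberg

theorem zI_inj {p : ℕ} {i j : Fin 3} : zI p i = zI p j ↔ i = j := by
  simp [zI, Fin.ext_iff]

theorem zI_ne_tI {p : ℕ} (i : Fin 3) (j : Fin 4) (r : Fin p) : zI p i ≠ tI p j r := by
  simp only [zI, tI, ne_eq, Fin.mk.injEq]
  omega

theorem tI_inj {p : ℕ} {i j : Fin 4} {r s : Fin p} : tI p i r = tI p j s ↔ i = j ∧ r = s := by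
  refine ⟨fun h => ?_, by rintro ⟨rfl, rfl⟩; rfl⟩
  have h' : (r : ℕ) + p * i = s + p * j := by
    have := congrArg Fin.val h
    simp only [tI] at this
    rw [mul_comm p, mul_comm p]
    omega
  have hp : 0 < p := r.pos
  have hmod := congrArg (· % p) h'
  have hdiv := congrArg (· / p) h'
  simp only [Nat.add_mul_mod_self_left, Nat.mod_eq_of_lt r.isLt, Nat.mod_eq_of_lt s.isLt] at hmod
  simp only [Nat.add_mul_div_left _ _ hp, Nat.div_eq_of_lt r.isLt, Nat.div_eq_of_lt s.isLt,
    zero_add] at hdiv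
  exact ⟨Fin.ext hdiv, Fin.ext hmod⟩

theorem eq_zI_or_eq_tI {p : ℕ} (b : Fin (4 * p + 3)) :
    (∃ i, b = zI p i) ∨ ∃ i r, b = tI p i r := by
  by_cases hb : b.val < 3
  · exact .inl ⟨⟨b, hb⟩, rfl⟩
  · have hp : 0 < p := by have := b.isLt; omega
    refine .inr ⟨⟨(b.val - 3) / p, ?_⟩, ⟨(b.val - 3) % p, Nat.mod_lt _ hp⟩, ?_⟩
    · rw [Nat.div_lt_iff_lt_mul hp]
      have := b.isLt
      omega
    · ext
      have := Nat.div_add_mod (b.val - 3) p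
      rw [mul_comm] at this
      simp only [tI]
      omega

theorem bracket_zI {p : ℕ} (lam : ℝ) (X Y : NV p) (i : Fin 3) :
    bracket p lam X Y (zI p i) = lam * bracket p 1 X Y (zI p i) := by
  fin_cases i <;> simp [bracket, xi, zI_inj]

theorem Hform_eq {p : ℕ} {lam : ℝ} (hlam : lam ≠ 0) (X Y : NV p) (i : Fin 3) :
    Hform p lam i X Y = bracket p 1 X Y (zI p i) +
      2 * etaWedge p (i + 1) (i + 2) X Y := by
  have h (j : Fin 3) : lam⁻¹ * dEta p lam j X Y = -bracket p 1 X Y (zI p j) := by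
    rw [dEta, bracket_zI]
    field_simp
  fin_cases i
  · simp [Hform, h]
  · simp [Hform, h, etaWedge, show (1 : Fin 3) + 1 = 2 from rfl, show (1 : Fin 3) + 2 = 0 from rfl]
    ring
  · simp [Hform, h, show (2 : Fin 3) + 1 = 0 from rfl, show (2 : Fin 3) + 2 = 1 from rfl]

theorem Hend_zI {p : ℕ} {lam : ℝ} (hlam : lam ≠ 0) (X : NV p) (i j : Fin 3) :
    Hend p lam i X (zI p j) =
      2 * (X (zI p (i + 1)) * (if i + 2 = j then 1 else 0) -
        X (zI p (i + 2)) * (if i + 1 = j then 1 else 0)) := by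
  have hz (k : Fin 4) (r : Fin p) : (Pi.single (zI p j) 1 : NV p) (tI p k r) = 0 :=
    Pi.single_eq_of_ne (zI_ne_tI j k r).symm _
  have hb : bracket p 1 X (Pi.single (zI p j) 1) = 0 := by
    simp [bracket, hz]
  rw [Hend, Hform_eq hlam, hb]
  simp only [etaWedge, Pi.zero_apply, Pi.single_apply, zI_inj]
  ring

theorem Hend_tI {p : ℕ} {lam : ℝ} (hlam : lam ≠ 0) (X : NV p) (i : Fin 3) (k : Fin 4)
    (r : Fin p) :
    Hend p lam i X (tI p k r) =
      ![![-X (tI p 1 r), X (tI p 0 r), -X (tI p 3 r), X (tI p 2 r)],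
        ![-X (tI p 2 r), X (tI p 3 r), X (tI p 0 r), -X (tI p 1 r)],
        ![-X (tI p 3 r), -X (tI p 2 r), X (tI p 1 r), X (tI p 0 r)]] i k := by
  have hz (j : Fin 3) : (Pi.single (tI p k r) 1 : NV p) (zI p j) = 0 :=
    Pi.single_eq_of_ne (zI_ne_tI j k r) _
  rw [Hend, Hform_eq hlam]
  simp only [etaWedge, hz]
  fin_cases i <;> fin_cases k <;>
    simp [bracket, xi, Pi.single_apply, zI_inj, tI_inj]

theorem connection_eq_neg_sum {p : ℕ} {lam : ℝ} {Om : NV p → NV p → NV p}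
    (hOmLin : ∀ (c : ℝ) (X X' Y : NV p), Om (c • X + X') Y = c • Om X Y + Om X' Y)
    (hOmXi : ∀ i : Fin 3, ∀ Y : NV p, Om (xi p i) Y = -(lam • Hend p lam i Y))
    (hOmTau : ∀ (i : Fin 4) (r : Fin p), ∀ Y : NV p, Om (tau p i r) Y = 0) (X Y : NV p) :
    Om X Y = -(lam • ∑ i, X (zI p i) • Hend p lam i Y) := by
  have h0 : Om 0 Y = 0 := by simpa using hOmLin 1 0 0 Y
  let L : NV p →ₗ[ℝ] NV p :=
    { toFun := fun X => Om X Y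
      map_add' := fun A B => by simpa using hOmLin 1 A B Y
      map_smul' := fun c A => by simpa [h0] using hOmLin c A 0 Y }
  let M : NV p →ₗ[ℝ] NV p :=
    -(lam • ∑ i, (LinearMap.proj (zI p i)).smulRight (Hend p lam i Y))
  have hLM : L = M := by
    refine (Pi.basisFun ℝ (Fin (4 * p + 3))).ext fun b => ?_
    rw [Pi.basisFun_apply]
    obtain ⟨i, rfl⟩ | ⟨i, r, rfl⟩ := eq_zI_or_eq_tI b
    · refine (hOmXi i Y).trans ?_
      simp [M, Pi.single_apply, zI_inj]
    · refine (hOmTau i r Y).trans ?_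
      simp [M, zI_ne_tI]
  simpa [L, M] using LinearMap.congr_fun hLM X

end QuaternionicHeisenberg

/-- for the linear map `Ω : n_p → End(n_p)` with `Ω(ξᵢ) = -λHᵢ` and
`Ω(τₗ) = 0`, the curvature of the corresponding left-invariant connection equals
`λ²(H₁⊗H₁ + H₂⊗H₂ + H₃⊗H₃)`, i.e. `[Ω(X), Ω(Y)] - Ω([X,Y]) = λ² Σᵢ Hᵢ(X,Y)·Hᵢ`. -/
theorem quaternionic_heisenberg_curvature_formula
    (p : ℕ) (hp : 1 ≤ p) (lam : ℝ) (hlam : 0 < lam)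
    (Om : NV p → NV p → NV p)
    (hOmLin : ∀ (c : ℝ) (X X' Y : NV p), Om (c • X + X') Y = c • Om X Y + Om X' Y)
    (hOmXi : ∀ i : Fin 3, ∀ Y : NV p, Om (xi p i) Y = -(lam • Hend p lam i Y))
    (hOmTau : ∀ (i : Fin 4) (r : Fin p), ∀ Y : NV p, Om (tau p i r) Y = 0) :
    ∀ X Y Z : NV p,
      Om X (Om Y Z) - Om Y (Om X Z) - Om (bracket p lam X Y) Z
        = lam ^ 2 • ∑ i : Fin 3, Hform p lam i X Y • Hend p lam i Z := by
  intro X Y Z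
  have hl : lam ≠ 0 := hlam.ne'
  have hOm := connection_eq_neg_sum hOmLin hOmXi hOmTau
  have e1 : (1 : Fin 3) + 1 = 2 := rfl
  have e2 : (1 : Fin 3) + 2 = 0 := rfl
  have e3 : (2 : Fin 3) + 1 = 0 := rfl
  have e4 : (2 : Fin 3) + 2 = 1 := rfl
  funext b
  simp only [hOm, bracket_zI lam, Hform_eq hl, etaWedge, Fin.sum_univ_three, Pi.sub_apply,
    Pi.neg_apply, Pi.smul_apply, Pi.add_apply, smul_eq_mul, e1, e2, e3, e4, zero_add]
  obtain ⟨j, rfl⟩ | ⟨k, r, rfl⟩ := eq_zI_or_eq_tI b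
  · simp only [Hend_zI hl, Pi.neg_apply, Pi.smul_apply, Pi.add_apply, smul_eq_mul,
      e1, e2, e3, e4, zero_add]
    fin_cases j <;> simp <;> ring
  · simp only [Hend_tI hl, Pi.neg_apply, Pi.smul_apply, Pi.add_apply, smul_eq_mul]
    fin_cases k <;> simp <;> ring
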